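/- An element p ∈ ℝ(X) belongs to the minimal Dress ring D if and only if there exist polynomials f, γ ∈ ℝ[X] such that γ(t) ≠ 0 for every t ∈ ℝ, deg f ≤ deg γ, and p = f/γ. -/

import Mathlib

open Polynomial

/-- The minimal Dress ring of `ℝ(X)`: the smallest subring of `RatFunc ℝ` containing
every element of the form `1/(1+x²)`. -/
noncomputable def DressD : Subring (RatFunc ℝ) :=
  Subring.closure {z : RatFunc ℝ | ∃ x : RatFunc ℝ, z = (1 + x ^ 2)⁻¹}

theorem inv_one_add_sq_mem_DressD (x : RatFunc ℝ) : (1 + x ^ 2)⁻¹ ∈ DressD :=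
  Subring.subset_closure ⟨x, rfl⟩

theorem algebraMap_C_mem_DressD (r : ℝ) : algebraMap ℝ[X] (RatFunc ℝ) (C r) ∈ DressD := by
  have unit_interval : ∀ s : ℝ, 0 < s → s ≤ 1 →
      algebraMap ℝ[X] (RatFunc ℝ) (C s) ∈ DressD := by
    intro s hs hs1
    have h := inv_one_add_sq_mem_DressD (algebraMap ℝ[X] (RatFunc ℝ) (C (√(s⁻¹ - 1))))
    convert h using 1
    apply eq_inv_of_mul_eq_one_left
    rw [← map_one (algebraMap ℝ[X] (RatFunc ℝ)), ← map_pow, ← map_add, ← map_mul]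
    congr 1
    rw [← C_pow, Real.sq_sqrt (by have := (one_le_inv₀ hs).2 hs1; linarith), ← C_1, ← C_add,
      ← C_mul]
    congr 1
    field_simp
    ring
  have pos : ∀ s : ℝ, 0 < s → algebraMap ℝ[X] (RatFunc ℝ) (C s) ∈ DressD := by
    intro s hs
    obtain ⟨n, hn⟩ := exists_nat_gt s
    have hn0 : (0 : ℝ) < n := hs.trans hn
    have h := DressD.mul_mem (natCast_mem DressD n)
      (unit_interval (s / n) (by positivity) ((div_le_one hn0).2 hn.le))
    convert h using 1
    rw [← map_natCast (algebraMap ℝ[X] (RatFunc ℝ)), ← map_mul, ← C_eq_natCast, ← C_mul,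
      mul_div_cancel₀ _ hn0.ne']
  rcases lt_trichotomy r 0 with h | h | h
  · simpa using DressD.neg_mem (pos (-r) (by linarith))
  · simp [h, DressD.zero_mem]
  · exact pos r h

theorem div_one_add_sq_mem_DressD {x : RatFunc ℝ} (hx : 1 + x ^ 2 ≠ 0) :
    x / (1 + x ^ 2) ∈ DressD := by
  have half : (1 / 2 : RatFunc ℝ) ∈ DressD := by
    convert inv_one_add_sq_mem_DressD 1 using 1
    norm_num
  by_cases h : 1 + x = 0
  · obtain rfl : x = -1 := by linear_combination h
    convert DressD.neg_mem half using 1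
    norm_num
  · convert DressD.sub_mem (inv_one_add_sq_mem_DressD ((1 - x) / (1 + x))) half using 1
    have e : 1 + ((1 - x) / (1 + x)) ^ 2 = 2 * (1 + x ^ 2) / (1 + x) ^ 2 := by
      field_simp
      ring
    rw [e, inv_div]
    field_simp
    ring

theorem linear_div_quadratic_mem_DressD {a b : ℝ} (hb : b ≠ 0) (c d : ℝ) :
    algebraMap ℝ[X] (RatFunc ℝ) (C c * X + C d) /
      algebraMap ℝ[X] (RatFunc ℝ) ((X - C a) ^ 2 + C (b ^ 2)) ∈ DressD := by
  set φ := algebraMap ℝ[X] (RatFunc ℝ)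
  have hφb : φ (C b) ≠ 0 := RatFunc.algebraMap_ne_zero (C_ne_zero.2 hb)
  have hQ : φ ((X - C a) ^ 2 + C (b ^ 2)) ≠ 0 := by
    refine RatFunc.algebraMap_ne_zero fun h => ?_
    have := congrArg (eval a) h
    simp [hb] at this
  set u : RatFunc ℝ := φ (X - C a) / φ (C b) with hu
  have hX : φ X = φ (C b) * u + φ (C a) := by
    rw [hu, mul_div_cancel₀ _ hφb, map_sub, sub_add_cancel]
  have hQu : φ ((X - C a) ^ 2 + C (b ^ 2)) = φ (C b) ^ 2 * (1 + u ^ 2) := by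
    simp only [map_add, map_pow, map_sub, hX]
    ring
  have hu0 : 1 + u ^ 2 ≠ 0 := fun h => hQ (by rw [hQu, h, mul_zero])
  have hbinv : φ (C b⁻¹) = (φ (C b))⁻¹ := by
    apply eq_inv_of_mul_eq_one_left
    rw [← map_mul, ← C_mul, inv_mul_cancel₀ hb, C_1, map_one]
  have hmem := DressD.add_mem
    (DressD.mul_mem (algebraMap_C_mem_DressD (c * b⁻¹)) (div_one_add_sq_mem_DressD hu0))
    (DressD.mul_mem (algebraMap_C_mem_DressD ((c * a + d) * b⁻¹ * b⁻¹))
      (inv_one_add_sq_mem_DressD u))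
  convert hmem using 1
  change _ = φ _ * _ + φ _ * _
  rw [hQu]
  simp only [map_add, map_mul, hX, hbinv]
  field_simp
  ring

theorem exists_quadratic_factor {γ : ℝ[X]} (hγ : ∀ t : ℝ, γ.eval t ≠ 0)
    (hdeg : γ.natDegree ≠ 0) :
    ∃ a b : ℝ, b ≠ 0 ∧ (X - C a) ^ 2 + C (b ^ 2) ∣ γ := by
  obtain ⟨z, hz⟩ := IsAlgClosed.exists_aeval_eq_zero ℂ γ
    (fun h => hdeg (natDegree_eq_of_degree_eq_some h))
  have him : z.im ≠ 0 := by
    intro h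
    have hre : z = algebraMap ℝ ℂ z.re := Complex.ext (by simp) (by simp [h])
    rw [hre, aeval_algebraMap_apply] at hz
    exact hγ z.re (by simpa using hz)
  refine ⟨z.re, z.im, him, ?_⟩
  convert γ.quadratic_dvd_of_aeval_eq_zero_im_ne_zero hz him using 1
  rw [Complex.sq_norm, Complex.normSq_apply]
  simp only [map_add, map_mul, map_pow, map_ofNat]
  ring

theorem div_mem_DressD {γ : ℝ[X]} (hγ : ∀ t : ℝ, γ.eval t ≠ 0) {f : ℝ[X]}
    (hf : f.natDegree ≤ γ.natDegree) :
    algebraMap ℝ[X] (RatFunc ℝ) f / algebraMap ℝ[X] (RatFunc ℝ) γ ∈ DressD := by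
  induction hn : γ.natDegree using Nat.strong_induction_on generalizing γ f with
  | _ n ih =>
    subst hn
    by_cases h0 : γ.natDegree = 0
    · obtain ⟨c, rfl⟩ := natDegree_eq_zero.1 h0
      obtain ⟨d, rfl⟩ := natDegree_eq_zero.1 (Nat.le_zero.1 (h0 ▸ hf))
      have hc : c ≠ 0 := by simpa using hγ 0
      convert algebraMap_C_mem_DressD (d / c) using 1
      rw [div_eq_iff (RatFunc.algebraMap_ne_zero (C_ne_zero.2 hc)), ← map_mul, ← C_mul,
        div_mul_cancel₀ _ hc]
    · obtain ⟨a, b, hb, δ, rfl⟩ := exists_quadratic_factor hγ h0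
      have hlin := linear_div_quadratic_mem_DressD (a := a) hb
      set Q : ℝ[X] := (X - C a) ^ 2 + C (b ^ 2) with hQdef
      have hQdeg : Q.natDegree = 2 := by
        rw [hQdef, natDegree_add_C, natDegree_pow, natDegree_X_sub_C]
      have hQ : Q.Monic := by
        refine ((monic_X_sub_C a).pow 2).add_of_left ?_
        rw [degree_pow, degree_X_sub_C]
        exact degree_C_le.trans_lt (by norm_num)
      have hδ : ∀ t : ℝ, δ.eval t ≠ 0 := fun t ht => hγ t (by rw [eval_mul, ht, mul_zero])
      have hδ0 : δ ≠ 0 := fun h => hδ 0 (by simp [h])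
      rw [hQ.natDegree_mul' hδ0, hQdeg] at hf ih
      have hquot := ih _ (by omega) hδ (f := f /ₘ Q)
        (by rw [natDegree_divByMonic _ hQ]; omega) rfl
      have hone := ih _ (by omega) hδ (f := 1) (by simp) rfl
      have hr : (f %ₘ Q).natDegree ≤ 1 := by
        have := natDegree_modByMonic_lt f hQ (fun h => by simp [h] at hQdeg)
        omega
      obtain ⟨c, d, hcd⟩ := exists_eq_X_add_C_of_natDegree_le_one hr
      have hrem := hlin c d
      rw [← hcd] at hrem
      convert DressD.add_mem hquot (DressD.mul_mem hrem hone) using 1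
      have hφQ := RatFunc.algebraMap_ne_zero hQ.ne_zero
      have hφδ := RatFunc.algebraMap_ne_zero hδ0
      nth_rw 1 [← modByMonic_add_div f Q]
      rw [map_add, map_mul, map_mul, map_one]
      field_simp
      ring

theorem exists_div_eq_inv_one_add_sq (x : RatFunc ℝ) :
    ∃ f γ : ℝ[X], (∀ t : ℝ, γ.eval t ≠ 0) ∧ f.degree ≤ γ.degree ∧
      (1 + x ^ 2)⁻¹ = algebraMap ℝ[X] (RatFunc ℝ) f / algebraMap ℝ[X] (RatFunc ℝ) γ := by
  refine ⟨x.denom ^ 2, x.num ^ 2 + x.denom ^ 2, fun t ht => ?_, ?_, ?_⟩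
  · obtain ⟨u, v, huv⟩ := RatFunc.isCoprime_num_denom x
    have h := congrArg (eval t) huv
    simp only [eval_add, eval_mul, eval_pow, eval_one] at h ht
    have h1 : x.num.eval t = 0 := by nlinarith [sq_nonneg (x.num.eval t)]
    have h2 : x.denom.eval t = 0 := by nlinarith [sq_nonneg (x.denom.eval t)]
    simp [h1, h2] at h
  · rw [degree_add_eq_of_leadingCoeff_add_ne_zero]
    · exact le_max_right _ _
    · rw [leadingCoeff_pow, leadingCoeff_pow, (RatFunc.monic_denom x).leadingCoeff]
      positivity
  · have hd : algebraMap ℝ[X] (RatFunc ℝ) x.denom ≠ 0 :=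
      RatFunc.algebraMap_ne_zero (RatFunc.denom_ne_zero x)
    have hx : algebraMap ℝ[X] (RatFunc ℝ) x.num = x * algebraMap ℝ[X] (RatFunc ℝ) x.denom :=
      (div_eq_iff hd).1 (RatFunc.num_div_denom x)
    rw [map_add, map_pow, map_pow, hx, mul_pow,
      show x ^ 2 * algebraMap ℝ[X] (RatFunc ℝ) x.denom ^ 2 +
        algebraMap ℝ[X] (RatFunc ℝ) x.denom ^ 2 =
        algebraMap ℝ[X] (RatFunc ℝ) x.denom ^ 2 * (1 + x ^ 2) by ring,
      div_mul_eq_div_div, div_self (pow_ne_zero 2 hd), one_div]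

theorem stmt_17 (p : RatFunc ℝ) :
    p ∈ DressD ↔ ∃ f γ : Polynomial ℝ, (∀ t : ℝ, γ.eval t ≠ 0) ∧ f.degree ≤ γ.degree ∧
      p = algebraMap (Polynomial ℝ) (RatFunc ℝ) f / algebraMap (Polynomial ℝ) (RatFunc ℝ) γ := by
  have ne_zero : ∀ γ : ℝ[X], (∀ t : ℝ, γ.eval t ≠ 0) →
      algebraMap ℝ[X] (RatFunc ℝ) γ ≠ 0 := fun γ hγ =>
    RatFunc.algebraMap_ne_zero fun h => hγ 0 (by simp [h])
  constructor
  · intro hp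
    induction hp using Subring.closure_induction with
    | mem z hz =>
      obtain ⟨x, rfl⟩ := hz
      exact exists_div_eq_inv_one_add_sq x
    | zero => exact ⟨0, 1, by simp, by simp, by simp⟩
    | one => exact ⟨1, 1, by simp, le_rfl, by simp⟩
    | add y z _ _ hy hz =>
      obtain ⟨f, γ, hγ, hf, rfl⟩ := hy
      obtain ⟨g, δ, hδ, hg, rfl⟩ := hz
      refine ⟨f * δ + γ * g, γ * δ, fun t => ?_, ?_, ?_⟩
      · rw [eval_mul]
        exact mul_ne_zero (hγ t) (hδ t)
      · refine (degree_add_le _ _).trans (max_le ?_ ?_)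
        · rw [degree_mul, degree_mul]
          gcongr
        · rw [degree_mul, degree_mul]
          gcongr
      · rw [div_add_div _ _ (ne_zero γ hγ) (ne_zero δ hδ)]
        simp only [map_add, map_mul]
    | neg y _ hy =>
      obtain ⟨f, γ, hγ, hf, rfl⟩ := hy
      exact ⟨-f, γ, hγ, by rwa [degree_neg], by rw [map_neg, neg_div]⟩
    | mul y z _ _ hy hz =>
      obtain ⟨f, γ, hγ, hf, rfl⟩ := hy
      obtain ⟨g, δ, hδ, hg, rfl⟩ := hz
      refine ⟨f * g, γ * δ, fun t => ?_, ?_, ?_⟩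
      · rw [eval_mul]
        exact mul_ne_zero (hγ t) (hδ t)
      · rw [degree_mul, degree_mul]
        gcongr
      · rw [div_mul_div_comm, map_mul, map_mul]
  · rintro ⟨f, γ, hγ, hf, rfl⟩
    exact div_mem_DressD hγ (natDegree_le_natDegree hf)
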